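/- Let η_b, η_h, H, η_e, γ be real numbers with 0 < η_b < 1, 0 < η_h < 1, H > 0, η_e > 0 and γ > 0, let τ, ν be real numbers, and let τ_cmax, τ_dmax, ν_cmax, ν_dmax be nonnegative real numbers. Then the four KKT stationarity equations −γ + η_b·τ − τ_cmax = 0, γ − τ/η_b − τ_dmax = 0, −γ·H/η_e + η_h·ν − ν_cmax = 0, and γ·H/η_e − ν/η_h − ν_dmax = 0 cannot all hold simultaneously. -/

import Mathlib

/-- For an efficiency `η` in `(0, 1)` and a positive price `p`, no storage value `t` makes
charging and discharging worthwhile at once. -/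
theorem lt_div_of_le_efficiency_mul {η p t : ℝ} (hη0 : 0 < η) (hη1 : η < 1) (hp : 0 < p)
    (h : p ≤ η * t) : p < t / η := by
  have ht : 0 < t := pos_of_mul_pos_right (hp.trans_le h) hη0.le
  rw [lt_div_iff₀ hη0]
  calc p * η < p := mul_lt_of_lt_one_right hp hη1
    _ ≤ η * t := h
    _ < t := mul_lt_of_lt_one_left ht hη1

/-- Core of Lemma 1: the four KKT stationarity equations cannot all hold
simultaneously when the efficiencies are strictly between 0 and 1,
`H, η_e, γ > 0`, and the upper-bound multipliers are nonnegative. -/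
theorem stmt_0 (ηb ηh H ηe γ τ ν τcmax τdmax νcmax νdmax : ℝ)
    (hηb0 : 0 < ηb) (hηb1 : ηb < 1) (hηh0 : 0 < ηh) (hηh1 : ηh < 1)
    (hH : 0 < H) (hηe : 0 < ηe) (hγ : 0 < γ)
    (hτc : 0 ≤ τcmax) (hτd : 0 ≤ τdmax) (hνc : 0 ≤ νcmax) (hνd : 0 ≤ νdmax) :
    ¬ (-γ + ηb * τ - τcmax = 0 ∧
       γ - τ / ηb - τdmax = 0 ∧
       -(γ * H / ηe) + ηh * ν - νcmax = 0 ∧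
       γ * H / ηe - ν / ηh - νdmax = 0) := by
  rintro ⟨hc, hd, -, -⟩
  have := lt_div_of_le_efficiency_mul hηb0 hηb1 hγ (t := τ) (by linarith)
  linarith
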